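/- arXiv:1910.10384 — 8 statements merged into one kernel-verified Lean document; each statement's English description precedes it below -/
import Mathlib

section
/- Every row of every matrix C_k has pairwise distinct entries: for all k ∈ [K], i ∈ {1,…,K−t} and j ≠ j' in {1,…,t+L}, C_k[i,j] ≠ C_k[i,j']. Hence each of the K(K−t) transmission vectors targets exactly t+L distinct users. -/
/-- Placement matrix: `Vmat K t p k = 1` iff `(k - p) mod K ∈ {0, …, t-1}`. -/
def Vmat (K t : ℕ) (p k : ℕ) : ℕ :=
  if 0 ≤ ((k : ℤ) - (p : ℤ)) % (K : ℤ) ∧ ((k : ℤ) - (p : ℤ)) % (K : ℤ) < (t : ℤ)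
  then 1 else 0

/-- Delivery prime matrix `C_1`. -/
def C1 (K t : ℕ) (i j : ℕ) : ℕ :=
  if j ≤ t then j
  else if j + i - 1 ≤ K then j + i - 1 else j + i - 1 - (K - t)

/-- Delivery prime matrix `R_1`. -/
def R1 (K t : ℕ) (i j : ℕ) : ℕ :=
  if j ≤ t then (if i ≤ K - 2 * t + j then t + i else i + 2 * t - K)
  else 1

/-- Round-`k` matrix `C_k`, entrywise circular increment of `C_1`. -/
def Cmat (K t : ℕ) (k i j : ℕ) : ℕ := ((C1 K t i j + k - 2) % K) + 1

/-- Round-`k` matrix `R_k`, entrywise circular increment of `R_1`. -/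
def Rmat (K t : ℕ) (k i j : ℕ) : ℕ := ((R1 K t i j + k - 2) % K) + 1

theorem C1_mem_Icc {K t L i j : ℕ} (hKtL : t + L ≤ K) (hi : i ∈ Finset.Icc 1 (K - t))
    (hj : j ∈ Finset.Icc 1 (t + L)) : C1 K t i j ∈ Finset.Icc 1 K := by
  simp only [Finset.mem_Icc] at *
  unfold C1
  split_ifs <;> omega

theorem C1_injOn {K t L i : ℕ} (hKtL : t + L ≤ K) (hi : i ∈ Finset.Icc 1 (K - t)) :
    Set.InjOn (C1 K t i) (Finset.Icc 1 (t + L)) := by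
  intro j hj j' hj' h
  simp only [Finset.coe_Icc, Set.mem_Icc, Finset.mem_Icc] at *
  unfold C1 at h
  split_ifs at h <;> omega

theorem add_sub_two_mod_injOn {K k : ℕ} (hk : 1 ≤ k) :
    Set.InjOn (fun a => (a + k - 2) % K) (Finset.Icc 1 K) := by
  intro a ha b hb h
  simp only [Finset.coe_Icc, Set.mem_Icc] at ha hb
  have e (c : ℕ) (hc : 1 ≤ c) : c + k - 2 = (c - 1) + (k - 1) := by omega
  have h' : (a - 1) + (k - 1) ≡ (b - 1) + (k - 1) [MOD K] := by
    rw [← e a ha.1, ← e b hb.1]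
    exact h
  have := (Nat.ModEq.add_right_cancel' _ h').eq_of_lt_of_lt (by omega) (by omega)
  omega

theorem stmt_5 (K t L : ℕ) (hK : 0 < K) (ht : 0 < t) (hL : 0 < L)
    (htL : t ≤ L) (hKtL : t + L ≤ K) :
    ∀ k ∈ Finset.Icc 1 K, ∀ i ∈ Finset.Icc 1 (K - t),
      ∀ j ∈ Finset.Icc 1 (t + L), ∀ j' ∈ Finset.Icc 1 (t + L),
        j ≠ j' → Cmat K t k i j ≠ Cmat K t k i j' := by
  intro k hk i hi j hj j' hj' hne h
  refine hne (C1_injOn hKtL hi hj hj' ?_)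
  exact add_sub_two_mod_injOn (Finset.mem_Icc.mp hk).1 (C1_mem_Icc hKtL hi hj)
    (C1_mem_Icc hKtL hi hj') (Nat.succ.inj h)
end

section
/- For each fixed column index j ∈ {1,…,t}, the map i ↦ R_1[i,j] is a bijection from {1,…,K−t} onto the set {p ∈ [K] : V[p,j] = 0} of part indices not cached by user j. -/
/-- For `j ≤ t ≤ K`, the parts of `[K]` not cached by user `j` are the `K - t` consecutive
indices following `j`. -/
lemma Vmat_eq_zero_iff {K t p j : ℕ} (hjt : j ≤ t) (htK : t ≤ K) (hp : p ∈ Set.Icc 1 K)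
    (hj : 1 ≤ j) : Vmat K t p j = 0 ↔ j < p ∧ p ≤ K - t + j := by
  obtain ⟨hp1, hpK⟩ := hp
  unfold Vmat
  rcases le_or_gt p j with h | h
  · rw [Int.emod_eq_of_lt (by omega) (by omega), if_pos (by omega)]
    omega
  · have hmod : ((j : ℤ) - p) % K = j - p + K := by
      rw [← Int.add_emod_right, Int.emod_eq_of_lt (by omega) (by omega)]
    rw [hmod]
    rw [ite_eq_right_iff, imp_iff_not one_ne_zero, not_and, not_lt]
    exact ⟨fun h0 => ⟨h, by have := h0 (by omega); omega⟩, fun _ _ => by omega⟩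

theorem stmt_6 (K t L : ℕ) (hK : 0 < K) (ht : 0 < t) (hL : 0 < L)
    (htL : t ≤ L) (hKtL : t + L ≤ K) :
    ∀ j ∈ Finset.Icc 1 t,
      Set.BijOn (fun i => R1 K t i j) (Set.Icc 1 (K - t))
        {p | p ∈ Set.Icc 1 K ∧ Vmat K t p j = 0} := by
  intro j hj
  obtain ⟨hj1, hjt⟩ := Finset.mem_Icc.mp hj
  have hset : {p | p ∈ Set.Icc 1 K ∧ Vmat K t p j = 0} = Set.Icc (j + 1) (K - t + j) := by
    ext p
    constructor
    · rintro ⟨hp, hV⟩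
      exact (Vmat_eq_zero_iff hjt (by omega) hp hj1).mp hV
    · rintro ⟨h₁, h₂⟩
      have hp : p ∈ Set.Icc 1 K := ⟨by omega, by omega⟩
      exact ⟨hp, (Vmat_eq_zero_iff hjt (by omega) hp hj1).mpr ⟨h₁, h₂⟩⟩
  rw [hset]
  simp only [R1, if_pos hjt]
  refine ⟨?_, ?_, ?_⟩
  · rintro i ⟨h₁, h₂⟩
    simp only [Set.mem_Icc]
    split_ifs <;> omega
  · rintro a ⟨ha₁, ha₂⟩ b ⟨hb₁, hb₂⟩ hab
    dsimp only at hab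
    split_ifs at hab <;> omega
  · rintro p ⟨h₁, h₂⟩
    rcases le_or_gt p t with h | h
    · refine ⟨p + K - 2 * t, ⟨by omega, by omega⟩, ?_⟩
      dsimp only
      split_ifs <;> omega
    · refine ⟨p - t, ⟨by omega, by omega⟩, ?_⟩
      dsimp only
      split_ifs <;> omega
end

section
/- For every round k ∈ [K] and every column j ∈ {1,…,t}: the entry C_k[i,j] does not depend on i and equals u := ((j + k − 2) mod K) + 1, and the map i ↦ R_k[i,j] is a bijection from {1,…,K−t} onto the set {p ∈ [K] : V[p,u] = 0} of part indices not cached by user u. -/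
theorem mod_eq_ite_of_lt_two_mul {K x : ℕ} (h : x < 2 * K) :
    x % K = if x < K then x else x - K := by
  split_ifs with hx
  · exact Nat.mod_eq_of_lt hx
  · rw [Nat.mod_eq_sub_mod (by omega), Nat.mod_eq_of_lt (by omega)]

theorem emod_eq_ite_of_abs_lt {K x : ℤ} (h₁ : -K < x) (h₂ : x < K) :
    x % K = if 0 ≤ x then x else x + K := by
  split_ifs with hx
  · exact Int.emod_eq_of_lt hx h₂
  · rw [← Int.add_emod_right, Int.emod_eq_of_lt (by omega) (by omega)]

theorem Vmat_eq_zero_iff_s7 {K t p u : ℕ} (hp : p ∈ Set.Icc 1 K) (hu : u ∈ Set.Icc 1 K) :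
    Vmat K t p u = 0 ↔ if p ≤ u then t + p ≤ u else t + p ≤ u + K := by
  obtain ⟨hp₁, hp₂⟩ := hp
  obtain ⟨hu₁, hu₂⟩ := hu
  rw [Vmat, emod_eq_ite_of_abs_lt (by omega) (by omega)]
  simp only [ite_eq_right_iff, one_ne_zero, imp_false]
  split_ifs <;> omega

/-- On the first `t` columns, `R_1` maps row indices onto the cyclic interval of
parts following the `j`-th one. -/
theorem bijOn_R1 {K t j : ℕ} (htK : 2 * t ≤ K) (hj : j ∈ Set.Icc 1 t) :
    Set.BijOn (fun i => R1 K t i j) (Set.Icc 1 (K - t)) (Set.Icc (j + 1) (j + (K - t))) := by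
  obtain ⟨hj₁, hj₂⟩ := hj
  simp only [R1, if_pos hj₂]
  refine ⟨?_, ?_, ?_⟩
  · rintro i ⟨hi₁, hi₂⟩
    simp only [Set.mem_Icc]
    split_ifs <;> omega
  · rintro a ⟨ha₁, ha₂⟩ b ⟨hb₁, hb₂⟩ hab
    simp only at hab
    split_ifs at hab <;> omega
  · rintro v ⟨hv₁, hv₂⟩
    refine ⟨if t < v then v - t else v + K - 2 * t, ?_, ?_⟩
    · simp only [Set.mem_Icc]
      split_ifs <;> omega
    · simp only
      split_ifs <;> omega

/-- The cyclic shift by `k - 1` maps the parts following the `j`-th one onto the parts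
not cached by the shifted user. -/
theorem bijOn_shift {K t k j : ℕ} (htK : t ≤ K) (hk : k ∈ Set.Icc 1 K)
    (hj : j ∈ Set.Icc 1 t) :
    Set.BijOn (fun v => (v + k - 2) % K + 1) (Set.Icc (j + 1) (j + (K - t)))
      {p | p ∈ Set.Icc 1 K ∧ Vmat K t p (((j + k - 2) % K) + 1) = 0} := by
  obtain ⟨hk₁, hk₂⟩ := hk
  obtain ⟨hj₁, hj₂⟩ := hj
  have hK : 0 < K := by omega
  have mem (x : ℕ) : x % K + 1 ∈ Set.Icc 1 K := ⟨by omega, Nat.mod_lt x hK⟩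
  refine ⟨?_, ?_, ?_⟩
  · rintro v ⟨hv₁, hv₂⟩
    refine ⟨mem _, ?_⟩
    rw [Vmat_eq_zero_iff_s7 (mem _) (mem _), mod_eq_ite_of_lt_two_mul (by omega),
      mod_eq_ite_of_lt_two_mul (by omega)]
    split_ifs <;> omega
  · rintro a ⟨ha₁, ha₂⟩ b ⟨hb₁, hb₂⟩ hab
    simp only at hab
    rw [mod_eq_ite_of_lt_two_mul (by omega), mod_eq_ite_of_lt_two_mul (by omega)] at hab
    split_ifs at hab <;> omega
  · rintro p ⟨hp, hV⟩
    rw [Vmat_eq_zero_iff_s7 hp (mem _), mod_eq_ite_of_lt_two_mul (by omega)] at hV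
    obtain ⟨hp₁, hp₂⟩ := hp
    refine ⟨if k ≤ p then p + 1 - k else p + K + 1 - k, ?_, ?_⟩
    · simp only [Set.mem_Icc]
      split_ifs at hV ⊢ <;> omega
    · simp only
      rw [mod_eq_ite_of_lt_two_mul (by split_ifs <;> omega)]
      split_ifs at hV ⊢ <;> omega

theorem stmt_7 (K t L : ℕ) (hK : 0 < K) (ht : 0 < t) (hL : 0 < L)
    (htL : t ≤ L) (hKtL : t + L ≤ K) :
    ∀ k ∈ Finset.Icc 1 K, ∀ j ∈ Finset.Icc 1 t,
      (∀ i ∈ Finset.Icc 1 (K - t), Cmat K t k i j = ((j + k - 2) % K) + 1) ∧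
      Set.BijOn (fun i => Rmat K t k i j) (Set.Icc 1 (K - t))
        {p | p ∈ Set.Icc 1 K ∧ Vmat K t p (((j + k - 2) % K) + 1) = 0} := by
  intro k hk j hj
  rw [Finset.mem_Icc] at hk hj
  refine ⟨fun i _ => by rw [Cmat, C1, if_pos hj.2], ?_⟩
  exact (bijOn_shift (by omega) hk hj).comp (bijOn_R1 (by omega) hj)
end

section
/- Every delivered part is missing from the cache of its target user: for all k ∈ [K], i ∈ {1,…,K−t} and j ∈ {1,…,t+L}, V[R_k[i,j], C_k[i,j]] = 0. -/
/-- The placement matrix is invariant under a common circular shift of its indices. -/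
lemma Vmat_circular_shift (K t k p c : ℕ) (hk : 1 ≤ k) (hp : 1 ≤ p) (hc : 1 ≤ c) :
    Vmat K t ((p + k - 2) % K + 1) ((c + k - 2) % K + 1) = Vmat K t p c := by
  have hmod : ((((c + k - 2) % K + 1 : ℕ) : ℤ) - (((p + k - 2) % K + 1 : ℕ) : ℤ)) % (K : ℤ)
      = ((c : ℤ) - (p : ℤ)) % (K : ℤ) := by
    push_cast [Nat.cast_sub (show 2 ≤ c + k by omega), Nat.cast_sub (show 2 ≤ p + k by omega)]
    rw [add_sub_add_right_eq_sub, ← Int.sub_emod]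
    congr 1
    ring
  unfold Vmat
  rw [hmod]

/-- `Vmat K t p c` vanishes when the circular distance from `p` to `c` is at least `t`. -/
lemma Vmat_eq_zero (K t p c : ℕ)
    (h : p + t ≤ c ∧ c < p + K ∨ c < p ∧ p + t ≤ c + K) : Vmat K t p c = 0 := by
  unfold Vmat
  refine if_neg fun hlt => ?_
  rcases h with h | h
  · rw [Int.emod_eq_of_lt (by omega) (by omega)] at hlt
    omega
  · rw [← Int.add_emod_right, Int.emod_eq_of_lt (by omega) (by omega)] at hlt
    omega

theorem stmt_8 (K t L : ℕ) (hK : 0 < K) (ht : 0 < t) (hL : 0 < L)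
    (htL : t ≤ L) (hKtL : t + L ≤ K) :
    ∀ k ∈ Finset.Icc 1 K, ∀ i ∈ Finset.Icc 1 (K - t), ∀ j ∈ Finset.Icc 1 (t + L),
      Vmat K t (Rmat K t k i j) (Cmat K t k i j) = 0 := by
  intro k hk i hi j hj
  rw [Finset.mem_Icc] at hk hi hj
  have hR : 1 ≤ R1 K t i j := by unfold R1; split_ifs <;> omega
  have hC : 1 ≤ C1 K t i j := by unfold C1; split_ifs <;> omega
  unfold Rmat Cmat
  rw [Vmat_circular_shift K t k _ _ hk.1 hR hC]
  apply Vmat_eq_zero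
  unfold R1 C1
  split_ifs <;> omega
end

section
/- In every transmission, each delivered part is cached by exactly t of the other targeted users: for all k ∈ [K], i ∈ {1,…,K−t} and j ∈ {1,…,t+L}, the number of indices j' ∈ {1,…,t+L} with j' ≠ j and V[R_k[i,j], C_k[i,j']] = 1 equals t (so each part must be zero-forced at exactly (t+L−1) − t = L−1 of the targeted users, which is feasible with L transmit antennas). -/
theorem Vmat_eq_one_iff {K t p k : ℕ} (hp : p ∈ Finset.Icc 1 K) (hk : k ∈ Finset.Icc 1 K) :
    Vmat K t p k = 1 ↔ (p ≤ k ∧ k < p + t) ∨ (k < p ∧ k + K < p + t) := by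
  rw [Finset.mem_Icc] at hp hk
  unfold Vmat
  rcases le_or_gt p k with h | h
  · rw [Int.emod_eq_of_lt (by omega) (by omega)]
    split_ifs <;> simp <;> omega
  · rw [← Int.add_emod_right, Int.emod_eq_of_lt (by omega) (by omega)]
    split_ifs <;> simp <;> omega

/-- The placement matrix is invariant under a simultaneous circular shift of both indices. -/
theorem Vmat_shift {K t p q k : ℕ} (hp : 0 < p) (hq : 0 < q) (hk : 0 < k) :
    Vmat K t ((p + k - 2) % K + 1) ((q + k - 2) % K + 1) = Vmat K t p q := by
  have h : ((((q + k - 2) % K + 1 : ℕ) : ℤ) - (((p + k - 2) % K + 1 : ℕ) : ℤ)) % (K : ℤ)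
      = ((q : ℤ) - (p : ℤ)) % (K : ℤ) := by
    push_cast
    rw [add_sub_add_right_eq_sub, ← Int.sub_emod]
    congr 1
    omega
  unfold Vmat
  rw [h]

theorem R1_mem_Icc {K t i j : ℕ} (hK : 0 < K) (htK : 2 * t ≤ K)
    (hi : i ∈ Finset.Icc 1 (K - t)) (hj : 0 < j) : R1 K t i j ∈ Finset.Icc 1 K := by
  rw [Finset.mem_Icc] at *
  unfold R1
  split_ifs <;> omega

theorem stmt_9 (K t L : ℕ) (hK : 0 < K) (ht : 0 < t) (hL : 0 < L)
    (htL : t ≤ L) (hKtL : t + L ≤ K) :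
    ∀ k ∈ Finset.Icc 1 K, ∀ i ∈ Finset.Icc 1 (K - t), ∀ j ∈ Finset.Icc 1 (t + L),
      ((Finset.Icc 1 (t + L)).filter
        (fun j' => j' ≠ j ∧ Vmat K t (Rmat K t k i j) (Cmat K t k i j') = 1)).card = t := by
  intro k hk i hi j hj
  have hk' := Finset.mem_Icc.1 hk
  have hi' := Finset.mem_Icc.1 hi
  have hj' := Finset.mem_Icc.1 hj
  have hR := R1_mem_Icc hK (by omega : 2 * t ≤ K) hi hj'.1
  have key : ∀ j' ∈ Finset.Icc 1 (t + L), (Vmat K t (Rmat K t k i j) (Cmat K t k i j') = 1 ↔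
      (R1 K t i j ≤ C1 K t i j' ∧ C1 K t i j' < R1 K t i j + t) ∨
      (C1 K t i j' < R1 K t i j ∧ C1 K t i j' + K < R1 K t i j + t)) := by
    intro j' hj2
    have hC := C1_mem_Icc hKtL hi hj2
    rw [Rmat, Cmat, Vmat_shift (Finset.mem_Icc.1 hR).1 (Finset.mem_Icc.1 hC).1 hk'.1,
      Vmat_eq_one_iff hR hC]
  rw [Finset.filter_congr fun m hm => and_congr_right fun _ => key m hm]
  -- The caching users occupy at most two intervals of columns.
  have count : ∀ a b c d : ℕ, b < c → (b + 1 - a) + (d + 1 - c) = t →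
      (∀ j', (1 ≤ j' ∧ j' ≤ t + L) ∧ j' ≠ j ∧
        ((R1 K t i j ≤ C1 K t i j' ∧ C1 K t i j' < R1 K t i j + t) ∨
        (C1 K t i j' < R1 K t i j ∧ C1 K t i j' + K < R1 K t i j + t)) ↔
        (a ≤ j' ∧ j' ≤ b) ∨ (c ≤ j' ∧ j' ≤ d)) →
      ((Finset.Icc 1 (t + L)).filter fun j' => j' ≠ j ∧
        ((R1 K t i j ≤ C1 K t i j' ∧ C1 K t i j' < R1 K t i j + t) ∨
        (C1 K t i j' < R1 K t i j ∧ C1 K t i j' + K < R1 K t i j + t))).card = t := by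
    intro a b c d hbc hcard h
    have hset : ((Finset.Icc 1 (t + L)).filter fun j' => j' ≠ j ∧
        ((R1 K t i j ≤ C1 K t i j' ∧ C1 K t i j' < R1 K t i j + t) ∨
        (C1 K t i j' < R1 K t i j ∧ C1 K t i j' + K < R1 K t i j + t)))
        = Finset.Icc a b ∪ Finset.Icc c d := by
      ext j'
      simpa only [Finset.mem_filter, Finset.mem_union, Finset.mem_Icc] using h j'
    rw [hset, Finset.card_union_of_disjoint, Nat.card_Icc, Nat.card_Icc, hcard]
    rw [Finset.disjoint_left]
    intro x hx hx'
    rw [Finset.mem_Icc] at hx hx'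
    omega
  by_cases hjt : j ≤ t
  · by_cases hij : i ≤ K - 2 * t + j
    · have hr : R1 K t i j = t + i := by rw [R1, if_pos hjt, if_pos hij]
      by_cases hw : 2 * t + i ≤ K + 1
      · refine count 1 0 (t + 1) (2 * t) (by omega) (by omega) fun j' => ?_
        rw [hr, C1]
        split_ifs <;> omega
      · refine count 1 (2 * t + i - 1 - K) (t + 1) (K + 1 - i) (by omega) (by omega) fun j' => ?_
        rw [hr, C1]
        split_ifs <;> omega
    · have hr : R1 K t i j = i + 2 * t - K := by rw [R1, if_pos hjt, if_neg hij]
      refine count (i + 2 * t - K) t (K + 2 - i) (2 * t) (by omega) (by omega) fun j' => ?_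
      rw [hr, C1]
      split_ifs <;> omega
  · have hr : R1 K t i j = 1 := by rw [R1, if_neg hjt]
    refine count 1 t (t + 1) t (by omega) (by omega) fun j' => ?_
    rw [hr, C1]
    split_ifs <;> omega
end

section
/- In every round k, the part delivered at the horizontal positions is part k, and it is cached by all users at the vertical positions: for all k ∈ [K], i ∈ {1,…,K−t} and j ∈ {t+1,…,t+L}, R_k[i,j] = k; and for all j' ∈ {1,…,t}, V[k, C_k[i,j']] = 1. -/
theorem stmt_11 (K t L : ℕ) (hK : 0 < K) (ht : 0 < t) (hL : 0 < L)
    (htL : t ≤ L) (hKtL : t + L ≤ K) :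
    ∀ k ∈ Finset.Icc 1 K, ∀ i ∈ Finset.Icc 1 (K - t),
      (∀ j ∈ Finset.Icc (t + 1) (t + L), Rmat K t k i j = k) ∧
      (∀ j' ∈ Finset.Icc 1 t, Vmat K t k (Cmat K t k i j') = 1) := by
  intro k hk i hi
  rw [Finset.mem_Icc] at hk
  refine ⟨fun j hj => ?_, fun j hj => ?_⟩
  · rw [Finset.mem_Icc] at hj
    rw [Rmat, R1, if_neg (by omega), Nat.mod_eq_of_lt (by omega)]
    omega
  · rw [Finset.mem_Icc] at hj
    have hmod : ((Cmat K t k i j : ℤ) - (k : ℤ)) % (K : ℤ) = (j : ℤ) - 1 := by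
      have hdiff : (Cmat K t k i j : ℤ) - (k : ℤ)
          = ((j : ℤ) - 1) + (K : ℤ) * (-((j + k - 2) / K : ℕ)) := by
        have hdiv := Nat.mod_add_div (j + k - 2) K
        rw [Cmat, C1, if_pos hj.2]
        zify [show 2 ≤ j + k by omega] at hdiv ⊢
        linarith
      rw [hdiff, Int.add_mul_emod_self_left, Int.emod_eq_of_lt (by omega) (by omega)]
    rw [Vmat, hmod, if_pos (by omega)]
end

section
/- During round k, every user missing part k appears exactly L times among the horizontal positions: for all k ∈ [K] and every u ∈ [K] with V[k,u] = 0, the number of pairs (i,j) with i ∈ {1,…,K−t}, j ∈ {t+1,…,t+L} and C_k[i,j] = u equals L. -/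
/-- The entry of `C_1` that becomes `u` in round `k`. -/
def primeEntry (K k u : ℕ) : ℕ := if k ≤ u then u - k + 1 else u + K - k + 1

/-- The row of `C_1` in which the horizontal column `j` contains the entry `v`. -/
def horizontalRow (K t v j : ℕ) : ℕ := if j ≤ v then v + 1 - j else v + 1 + (K - t) - j

theorem lt_primeEntry_of_Vmat_eq_zero {K t k u : ℕ} (hk : 1 ≤ k) (hkK : k ≤ K) (hu : 1 ≤ u)
    (huK : u ≤ K) (h : Vmat K t k u = 0) : t < primeEntry K k u ∧ primeEntry K k u ≤ K := by
  have hr : ((u : ℤ) - (k : ℤ)) % (K : ℤ) = (primeEntry K k u : ℤ) - 1 := by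
    unfold primeEntry
    split_ifs with hku
    · rw [Int.emod_eq_of_lt (by omega) (by omega)]
      omega
    · rw [← Int.add_emod_right, Int.emod_eq_of_lt (by omega) (by omega)]
      omega
  have hle : 1 ≤ primeEntry K k u ∧ primeEntry K k u ≤ K := by
    unfold primeEntry
    split_ifs <;> omega
  unfold Vmat at h
  rw [hr] at h
  split_ifs at h with hc
  omega

theorem mod_add_one_eq_iff_eq_primeEntry {K k u c : ℕ} (hk : 1 ≤ k) (hkK : k ≤ K) (hu : 1 ≤ u)
    (huK : u ≤ K) (hc : 1 ≤ c) (hcK : c ≤ K) (hck : 2 ≤ c + k) :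
    (c + k - 2) % K + 1 = u ↔ c = primeEntry K k u := by
  unfold primeEntry
  rcases lt_or_ge (c + k - 2) K with h | h
  · rw [Nat.mod_eq_of_lt h]
    split_ifs <;> omega
  · rw [Nat.mod_eq_sub_mod h, Nat.mod_eq_of_lt (by omega)]
    split_ifs <;> omega

theorem C1_horizontal_mem {K t L i j : ℕ} (hKtL : t + L ≤ K) (hi : 1 ≤ i) (hiK : i ≤ K - t)
    (hj : t + 1 ≤ j) (hjL : j ≤ t + L) : t < C1 K t i j ∧ C1 K t i j ≤ K := by
  unfold C1
  split_ifs <;> omega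

theorem C1_horizontal_eq_iff {K t L v i j : ℕ} (hKtL : t + L ≤ K) (hv : t < v) (hvK : v ≤ K)
    (hj : t + 1 ≤ j) (hjL : j ≤ t + L) :
    (1 ≤ i ∧ i ≤ K - t) ∧ C1 K t i j = v ↔ i = horizontalRow K t v j := by
  unfold C1 horizontalRow
  split_ifs <;> omega

theorem stmt_12 (K t L : ℕ) (hK : 0 < K) (ht : 0 < t) (hL : 0 < L)
    (htL : t ≤ L) (hKtL : t + L ≤ K) :
    ∀ k ∈ Finset.Icc 1 K, ∀ u ∈ Finset.Icc 1 K, Vmat K t k u = 0 →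
      (((Finset.Icc 1 (K - t)) ×ˢ (Finset.Icc (t + 1) (t + L))).filter
        (fun x => Cmat K t k x.1 x.2 = u)).card = L := by
  intro k hk u hu hV
  rw [Finset.mem_Icc] at hk hu
  obtain ⟨hv, hvK⟩ := lt_primeEntry_of_Vmat_eq_zero hk.1 hk.2 hu.1 hu.2 hV
  have himage : ((Finset.Icc 1 (K - t)) ×ˢ (Finset.Icc (t + 1) (t + L))).filter
      (fun x => Cmat K t k x.1 x.2 = u) =
      (Finset.Icc (t + 1) (t + L)).image
        (fun j => (horizontalRow K t (primeEntry K k u) j, j)) := by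
    ext ⟨i, j⟩
    simp only [Finset.mem_filter, Finset.mem_product, Finset.mem_image, Finset.mem_Icc,
      Prod.mk.injEq]
    constructor
    · rintro ⟨⟨hi, hj⟩, h⟩
      obtain ⟨hc, hcK⟩ := C1_horizontal_mem hKtL hi.1 hi.2 hj.1 hj.2
      have hC := (mod_add_one_eq_iff_eq_primeEntry hk.1 hk.2 hu.1 hu.2 (by omega) hcK
        (by omega)).1 h
      exact ⟨j, hj, ((C1_horizontal_eq_iff hKtL hv hvK hj.1 hj.2).1 ⟨hi, hC⟩).symm, rfl⟩
    · rintro ⟨j', hj, h, rfl⟩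
      obtain ⟨hi, hC⟩ := (C1_horizontal_eq_iff hKtL hv hvK hj.1 hj.2).2 h.symm
      obtain ⟨hc, hcK⟩ := C1_horizontal_mem hKtL hi.1 hi.2 hj.1 hj.2
      exact ⟨⟨hi, hj⟩, (mod_add_one_eq_iff_eq_primeEntry hk.1 hk.2 hu.1 hu.2 (by omega) hcK
        (by omega)).2 hC⟩
  rw [himage, Finset.card_image_of_injective _ (fun a b h => (Prod.mk.inj h).2), Nat.card_Icc]
  omega
end

section
/- Across all rounds, every missing (user, part) pair is served exactly t + L times in total: for all u, p ∈ [K] with V[p,u] = 0, the number of triples (k,i,j) with k ∈ [K], i ∈ {1,…,K−t}, j ∈ {1,…,t+L}, C_k[i,j] = u and R_k[i,j] = p equals t + L. Consequently each part W_p must be split into t + L subpackets, giving total subpacketization K(t+L). -/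
/-- A one-based circular shift of `a` hits `u` iff `a + k - 1` is `u` or `u + K`. -/
theorem circular_shift_eq_iff {K a k u : ℕ} (ha : 1 ≤ a) (haK : a ≤ K) (hk : 1 ≤ k)
    (hkK : k ≤ K) (hu : 1 ≤ u) (huK : u ≤ K) :
    (a + k - 2) % K + 1 = u ↔ a + k = u + 1 ∨ a + k = u + 1 + K := by
  rcases lt_or_ge (a + k - 2) K with h | h
  · rw [Nat.mod_eq_of_lt h]
    omega
  · rw [Nat.mod_eq_sub_mod h, Nat.mod_eq_of_lt (by omega)]
    omega

/-- A part that a user misses lies at circular distance at least `t` from that user. -/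
theorem exists_distance_of_Vmat_eq_zero {K t p u : ℕ} (hp : 1 ≤ p) (hpK : p ≤ K)
    (hu : 1 ≤ u) (huK : u ≤ K) (h : Vmat K t p u = 0) :
    ∃ d, t ≤ d ∧ d < K ∧ (p + d = u ∨ p + d = u + K) := by
  have hK : (0 : ℤ) < K := by omega
  have h0 := Int.emod_nonneg ((u : ℤ) - p) hK.ne'
  have hlt := Int.emod_lt_of_pos ((u : ℤ) - p) hK
  have ht : (t : ℤ) ≤ ((u : ℤ) - p) % K := by
    by_contra hc
    simp [Vmat, h0, not_le.mp hc] at h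
  rcases le_or_gt p u with hpu | hpu
  · rw [Int.emod_eq_of_lt (by omega) (by omega)] at ht
    exact ⟨u - p, by omega, by omega, by omega⟩
  · rw [← Int.add_emod_right, Int.emod_eq_of_lt (by omega) (by omega)] at ht
    exact ⟨u + K - p, by omega, by omega, by omega⟩

theorem C1_mem {K t L i j : ℕ} (hKtL : t + L ≤ K) (hi : 1 ≤ i) (hiK : i ≤ K - t)
    (hj : 1 ≤ j) (hjL : j ≤ t + L) : 1 ≤ C1 K t i j ∧ C1 K t i j ≤ K := by
  unfold C1
  split_ifs <;> omega

theorem R1_mem {K t i j : ℕ} (hK : 0 < K) (htK : 2 * t ≤ K) (hi : 1 ≤ i)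
    (hiK : i ≤ K - t) : 1 ≤ R1 K t i j ∧ R1 K t i j ≤ K := by
  unfold R1
  split_ifs <;> omega

theorem stmt_14 (K t L : ℕ) (hK : 0 < K) (ht : 0 < t) (hL : 0 < L)
    (htL : t ≤ L) (hKtL : t + L ≤ K) :
    ∀ u ∈ Finset.Icc 1 K, ∀ p ∈ Finset.Icc 1 K, Vmat K t p u = 0 →
      (((Finset.Icc 1 K) ×ˢ (Finset.Icc 1 (K - t)) ×ˢ (Finset.Icc 1 (t + L))).filter
        (fun x => Cmat K t x.1 x.2.1 x.2.2 = u ∧ Rmat K t x.1 x.2.1 x.2.2 = p)).card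
        = t + L := by
  intro u hu p hp hV
  obtain ⟨hu, huK⟩ := Finset.mem_Icc.mp hu
  obtain ⟨hp, hpK⟩ := Finset.mem_Icc.mp hp
  obtain ⟨d, htd, hdK, hd⟩ := exists_distance_of_Vmat_eq_zero hp hpK hu huK hV
  have served_iff : ∀ k i j, 1 ≤ k → k ≤ K → 1 ≤ i → i ≤ K - t → 1 ≤ j → j ≤ t + L →
      (Cmat K t k i j = u ∧ Rmat K t k i j = p ↔
        (C1 K t i j + k = u + 1 ∨ C1 K t i j + k = u + 1 + K) ∧
        (R1 K t i j + k = p + 1 ∨ R1 K t i j + k = p + 1 + K)) := by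
    intro k i j hk hkK hi hiK hj hjL
    have hC := C1_mem hKtL hi hiK hj hjL
    have hR := R1_mem (j := j) hK (by omega) hi hiK
    exact and_congr (circular_shift_eq_iff hC.1 hC.2 hk hkK hu huK)
      (circular_shift_eq_iff hR.1 hR.2 hk hkK hp hpK)
  -- In each column exactly one row and one round serve the pair.
  suffices h : _ = (Finset.Icc 1 (t + L)).card by simpa using h
  refine Finset.card_bij (fun x _ => x.2.2) ?_ ?_ ?_
  · intro x hx
    simp only [Finset.mem_filter, Finset.mem_product] at hx
    exact hx.1.2.2
  · rintro ⟨k, i, j⟩ hx ⟨k', i', j'⟩ hx' (rfl : j = j')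
    simp only [Finset.mem_filter, Finset.mem_product, Finset.mem_Icc] at hx hx'
    obtain ⟨⟨⟨hk, hkK⟩, ⟨hi, hiK⟩, hj, hjL⟩, h⟩ := hx
    obtain ⟨⟨⟨hk', hkK'⟩, ⟨hi', hiK'⟩, -, -⟩, h'⟩ := hx'
    rw [served_iff k i j hk hkK hi hiK hj hjL] at h
    rw [served_iff k' i' j hk' hkK' hi' hiK' hj hjL] at h'
    have hki : k = k' ∧ i = i' := by
      unfold C1 R1 at h h'
      by_cases hjt : j ≤ t
      · simp only [hjt, if_true] at h h'
        have hkk : k = k' := by omega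
        subst hkk
        refine ⟨rfl, ?_⟩
        split_ifs at h h' <;> omega
      · simp only [hjt, if_false] at h h'
        have hkk : k = k' := by omega
        subst hkk
        refine ⟨rfl, ?_⟩
        split_ifs at h h' <;> omega
    rw [hki.1, hki.2]
  · intro j hj
    obtain ⟨hj, hjL⟩ := Finset.mem_Icc.mp hj
    obtain ⟨k, i, hk, hkK, hi, hiK, h⟩ : ∃ k i, 1 ≤ k ∧ k ≤ K ∧ 1 ≤ i ∧ i ≤ K - t ∧
        (C1 K t i j + k = u + 1 ∨ C1 K t i j + k = u + 1 + K) ∧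
        (R1 K t i j + k = p + 1 ∨ R1 K t i j + k = p + 1 + K) := by
      unfold C1 R1
      by_cases hjt : j ≤ t
      · simp only [hjt, if_true]
        refine ⟨if j ≤ u then u + 1 - j else u + 1 + K - j,
          if t < j + K - d then j + K - d - t else j + K - d + K - 2 * t, ?_⟩
        split_ifs <;> omega
      · simp only [hjt, if_false]
        refine ⟨p, if j < d + 2 then d + 2 - j else d + 2 + (K - t) - j, ?_⟩
        split_ifs <;> omega
    refine ⟨(k, i, j), ?_, rfl⟩
    simp only [Finset.mem_filter, Finset.mem_product, Finset.mem_Icc]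
    exact ⟨⟨⟨hk, hkK⟩, ⟨hi, hiK⟩, hj, hjL⟩, (served_iff k i j hk hkK hi hiK hj hjL).mpr h⟩
end
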